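/- Let n ≥ 5 and let H be the complete (n−2)-uniform hypergraph on {1,...,n}. Then for every r with −1 ≤ r ≤ 1, dim HC_r(Δ(H)) = C(n, r+1). -/

import Mathlib

open Function

/-- The map `Fin (m+1) → Fin m` which merges the blocks `j` and `j+1` of an
ordered set partition with `m+1` blocks (blocks are indexed from `0`). -/
def mergeMap {m : ℕ} (j : Fin m) : Fin (m + 1) → Fin m := fun x =>
  if h : (x : ℕ) ≤ (j : ℕ) then ⟨(x : ℕ), lt_of_le_of_lt h j.isLt⟩
  else ⟨(x : ℕ) - 1, by have h1 := x.isLt; have h2 := j.isLt; omega⟩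

/-- The linear map between spaces of `R`-valued functions on finite bases
given by a "matrix" `M` (rows indexed by `α`, columns by `β`). -/
def matLin {R : Type} [CommRing R] {α β : Type} [Fintype α] (M : α → β → R) :
    (α → R) →ₗ[R] (β → R) where
  toFun c := fun b => ∑ a, c a * M a b
  map_add' x y := by
    funext b
    simp [add_mul, Finset.sum_add_distrib]
  map_smul' r x := by
    funext b
    simp [Finset.mul_sum, mul_assoc]

/-- Homology of a (piece of a) chain complex: the kernel of the outgoing map `d1`
modulo the image of the incoming map `d2`. -/
abbrev homologyOf {R A B C : Type} [CommRing R] [AddCommGroup A] [AddCommGroup B] [AddCommGroup C]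
    [Module R A] [Module R B] [Module R C] (d2 : A →ₗ[R] B) (d1 : B →ₗ[R] C) :=
  LinearMap.ker d1 ⧸ (LinearMap.range d2).comap (LinearMap.ker d1).subtype

/-- The canonical representatives of faces of the cyclic coloring complex:
ordered set partitions of `{0, …, n-1}` (vertex `i` stands for the vertex `i+1` of the paper)
into `m` nonempty blocks, encoded as surjections `f : Fin n → Fin m` (block `B_{i+1}` is the
fiber `f⁻¹ i`), such that the block containing the vertex `0` is the first one, and
satisfying the extra condition `P m f` (used to encode hyperedge conditions). -/
def CycBas (n : ℕ) (P : (m : ℕ) → (Fin n → Fin m) → Prop) (m : ℕ) :=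
  {f : Fin n → Fin m // Surjective f ∧ (∀ x : Fin n, (x : ℕ) = 0 → (f x : ℕ) = 0) ∧ P m f}

instance (n : ℕ) (P : (m : ℕ) → (Fin n → Fin m) → Prop) (m : ℕ) : Finite (CycBas n P m) := by
  unfold CycBas; infer_instance

noncomputable instance (n : ℕ) (P : (m : ℕ) → (Fin n → Fin m) → Prop) (m : ℕ) :
    Fintype (CycBas n P m) := Fintype.ofFinite _

instance (n : ℕ) (P : (m : ℕ) → (Fin n → Fin m) → Prop) (m : ℕ) :
    DecidableEq (CycBas n P m) := by unfold CycBas; infer_instance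

/-- The matrix of the boundary map of the cyclic coloring complex, from chains with `m+1`
blocks to chains with `m` blocks.  The first summand comes from merging consecutive blocks
`B_i, B_{i+1}` (`1 ≤ i ≤ r+1`, with sign `(-1)^{i+1}`), the second from merging `B_1` with the
last block `B_{r+2}` (with sign `(-1)^{r+3}`, and `r + 2 = m + 1`).  Terms whose merged
partition does not satisfy the condition `P` do not appear (they match no element `g`). -/
def cycMat (n : ℕ) (P : (m : ℕ) → (Fin n → Fin m) → Prop) (m : ℕ)
    (f : CycBas n P (m + 1)) (g : CycBas n P m) : ℚ :=
  (∑ j : Fin m, (-1 : ℚ) ^ (j : ℕ) * (if mergeMap j ∘ f.1 = g.1 then 1 else 0))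
    + (-1 : ℚ) ^ m * (if (∀ y : Fin n, ((f.1 y : ℕ) = m → (g.1 y : ℕ) = 0) ∧
        ((f.1 y : ℕ) ≠ m → (g.1 y : ℕ) = (f.1 y : ℕ))) then 1 else 0)

/-- The boundary map of the cyclic coloring complex. -/
noncomputable def cycBnd (n : ℕ) (P : (m : ℕ) → (Fin n → Fin m) → Prop) (m : ℕ) :
    (CycBas n P (m + 1) → ℚ) →ₗ[ℚ] (CycBas n P m → ℚ) := matLin (cycMat n P m)

/-- Hyperedge condition for the complex `Δ(H)` where `H` is the complete `k`-uniform
hypergraph on `n` vertices: at least one block (= fiber of `f`) contains a hyperedge,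
i.e. some `k`-element subset of the vertices lies inside one block. -/
def completeIn (n k : ℕ) : (m : ℕ) → (Fin n → Fin m) → Prop := fun m f =>
  ∃ e : Finset (Fin n), e.card = k ∧ ∃ i : Fin m, ∀ x ∈ e, f x = i

/-- Hyperedge condition for the complex `Δ(H)` where `H` is the `k`-uniform star
hypergraph at the vertex `1` (encoded as the element of `Fin n` with value `0`):
some block contains a `k`-element set containing the vertex `1`. -/
def starIn (n k : ℕ) : (m : ℕ) → (Fin n → Fin m) → Prop := fun m f =>
  ∃ e : Finset (Fin n), e.card = k ∧ (∀ x : Fin n, (x : ℕ) = 0 → x ∈ e) ∧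
    ∃ i : Fin m, ∀ x ∈ e, f x = i

/-- Condition for the quotient complex `Δ(H)^C` where `H` is the complete `k`-uniform
hypergraph: no block contains a hyperedge. -/
def completeFree (n k : ℕ) : (m : ℕ) → (Fin n → Fin m) → Prop := fun m f =>
  ∀ e : Finset (Fin n), e.card = k → ∀ i : Fin m, ∃ x ∈ e, f x ≠ i

/-- Condition for the quotient complex `Δ(H')^C` where `H'` is the `k`-uniform star
hypergraph at the vertex `1`: no block contains a hyperedge of `H'`. -/
def starFree (n k : ℕ) : (m : ℕ) → (Fin n → Fin m) → Prop := fun m f =>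
  ∀ e : Finset (Fin n), e.card = k → (∀ x : Fin n, (x : ℕ) = 0 → x ∈ e) →
    ∀ i : Fin m, ∃ x ∈ e, f x ≠ i

/-- The two-block partition with small block `S`, normalised so that the block of the vertex `0`
comes first. -/
def cutColoring {n : ℕ} [NeZero n] (S : Finset (Fin n)) : Fin n → Fin 2 := fun x =>
  (if x ∈ S then 1 else 0) - (if (0 : Fin n) ∈ S then 1 else 0)

/-- The cyclic position of a vertex in the three-block partition consisting of a large block
followed by the singletons `{a}` and `{b}`. -/
def pairPosition {n : ℕ} (a b : Fin n) : Fin n → Fin 3 := fun x =>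
  if x = a then 1 else if x = b then 2 else 0

/-- The three-block partition consisting of a large block followed cyclically by `{a}` and `{b}`,
normalised so that the block of the vertex `0` comes first. -/
def pairColoring {n : ℕ} [NeZero n] (a b : Fin n) : Fin n → Fin 3 := fun x =>
  pairPosition a b x - pairPosition a b 0

theorem Fin.zero_of_val_eq_zero {n : ℕ} [NeZero n] {x : Fin n} (h : (x : ℕ) = 0) : x = 0 :=
  Fin.ext (by simpa using h)

theorem cutColoring_injective {n : ℕ} [NeZero n] {S T : Finset (Fin n)} (hST : S.card + T.card < n)
    (h : cutColoring S = cutColoring T) : S = T := by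
  obtain ⟨z, hz⟩ : ∃ z, z ∉ S ∪ T := by
    by_contra! hc
    have h1 : S ∪ T = Finset.univ := Finset.eq_univ_iff_forall.2 hc
    have h2 := Finset.card_union_le S T
    rw [h1, Finset.card_univ, Fintype.card_fin] at h2
    omega
  simp only [Finset.mem_union, not_or] at hz
  have hz' := congrFun h z
  ext x
  have hx := congrFun h x
  simp only [cutColoring, hz.1, hz.2, if_false] at hz' hx
  split_ifs at hz' hx <;> simp_all

theorem pairPosition_zero_of_ne {n : ℕ} {a b x : Fin n} (ha : x ≠ a) (hb : x ≠ b) :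
    pairPosition a b x = 0 := by simp [pairPosition, ha, hb]

theorem pairColoring_injective {n : ℕ} [NeZero n] (hn : 5 ≤ n) {a b c d : Fin n} (hab : a ≠ b)
    (h : pairColoring a b = pairColoring c d) : a = c ∧ b = d := by
  obtain ⟨z, hz⟩ : ∃ z, z ∉ ({a, b, c, d} : Finset (Fin n)) := by
    by_contra! hc
    have h1 : ({a, b, c, d} : Finset (Fin n)) = Finset.univ := Finset.eq_univ_iff_forall.2 hc
    have h2 := Finset.card_le_four (a := a) (b := b) (c := c) (d := d)
    rw [h1, Finset.card_univ, Fintype.card_fin] at h2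
    omega
  simp only [Finset.mem_insert, Finset.mem_singleton, not_or] at hz
  obtain ⟨za, zb, zc, zd⟩ := hz
  have hz' := congrFun h z
  simp only [pairColoring, pairPosition_zero_of_ne za zb, pairPosition_zero_of_ne zc zd] at hz'
  have h0 : pairPosition a b 0 = pairPosition c d 0 := by simpa using hz'
  have hx : ∀ x, pairPosition a b x = pairPosition c d x := fun x => by
    simpa [pairColoring, h0] using congrFun h x
  have h1 := hx a
  have h2 := hx b
  simp only [pairPosition] at h1 h2
  constructor
  · split_ifs at h1 <;> simp_all
  · split_ifs at h2 <;> simp_all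

theorem exists_cutColoring {n : ℕ} [NeZero n] {f : Fin n → Fin 2} (hf : Surjective f)
    (h0 : f 0 = 0) (hP : completeIn n (n - 2) 2 f) :
    ∃ S : Finset (Fin n), (S.card = 1 ∨ S.card = 2) ∧ cutColoring S = f := by
  obtain ⟨e, he, i, hi⟩ := hP
  refine ⟨Finset.univ.filter (fun x => f x ≠ i), ?_, ?_⟩
  · have h1 : Finset.univ.filter (fun x => f x ≠ i) ⊆ eᶜ := by
      intro x hx
      simp only [Finset.mem_filter, Finset.mem_univ, true_and, Finset.mem_compl] at hx ⊢
      exact fun hxe => hx (hi x hxe)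
    have h2 := Finset.card_le_card h1
    rw [Finset.card_compl, Fintype.card_fin, he] at h2
    obtain ⟨x, hx⟩ := hf (i + 1)
    have h3 : 0 < (Finset.univ.filter (fun x => f x ≠ i)).card :=
      Finset.card_pos.2 ⟨x, by simp [hx]⟩
    omega
  · funext x
    simp only [cutColoring, Finset.mem_filter, Finset.mem_univ, true_and, h0]
    generalize f x = y
    clear hi
    decide +revert

theorem exists_pairColoring {n : ℕ} [NeZero n] (hn : 2 ≤ n) {f : Fin n → Fin 3}
    (hf : Surjective f) (h0 : f 0 = 0) (hP : completeIn n (n - 2) 3 f) :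
    ∃ a b : Fin n, a ≠ b ∧ pairColoring a b = f := by
  obtain ⟨e, he, i, hi⟩ := hP
  obtain ⟨a, ha⟩ := hf (i + 1)
  obtain ⟨b, hb⟩ := hf (i + 2)
  have hab : a ≠ b := by
    rintro rfl
    rw [ha] at hb
    simp at hb
  have hsub : ({a, b} : Finset (Fin n)) ⊆ eᶜ := by
    intro x hx
    simp only [Finset.mem_insert, Finset.mem_singleton] at hx
    rw [Finset.mem_compl]
    intro hxe
    have := hi x hxe
    rcases hx with rfl | rfl
    · rw [ha] at this; simp at this
    · rw [hb] at this; simp at this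
  have heq : ({a, b} : Finset (Fin n)) = eᶜ := by
    refine Finset.eq_of_subset_of_card_le hsub ?_
    rw [Finset.card_compl, Fintype.card_fin, he, Finset.card_pair hab]
    omega
  have hpos : ∀ x, f x = pairPosition a b x + i := by
    intro x
    unfold pairPosition
    split_ifs with h1 h2
    · rw [h1, ha, add_comm]
    · rw [h2, hb, add_comm]
    · have hx : x ∉ eᶜ := by rw [← heq]; simp [h1, h2]
      rw [hi x (by simpa using hx), zero_add]
  refine ⟨a, b, hab, funext fun x => ?_⟩
  have h := hpos 0
  rw [h0] at h
  rw [pairColoring, hpos x, sub_eq_add_neg, eq_neg_of_add_eq_zero_right h.symm]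

theorem cutColoring_mem {n : ℕ} [NeZero n] (hn : 5 ≤ n) {S : Finset (Fin n)}
    (hS : S.card = 1 ∨ S.card = 2) :
    Surjective (cutColoring S) ∧ (∀ x : Fin n, (x : ℕ) = 0 → (cutColoring S x : ℕ) = 0) ∧
      completeIn n (n - 2) 2 (cutColoring S) := by
  have hc : Sᶜ.card = n - S.card := by rw [Finset.card_compl, Fintype.card_fin]
  refine ⟨fun y => ?_, fun x hx => ?_, ?_⟩
  · obtain ⟨s, hs⟩ : S.Nonempty := Finset.card_pos.1 (by omega)
    obtain ⟨t, ht⟩ : Sᶜ.Nonempty := Finset.card_pos.1 (by omega)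
    rw [Finset.mem_compl] at ht
    by_cases h : y + (if (0 : Fin n) ∈ S then 1 else 0) = 1
    · exact ⟨s, by rw [cutColoring, if_pos hs]; exact sub_eq_of_eq_add h.symm⟩
    · refine ⟨t, ?_⟩
      have h' : y + (if (0 : Fin n) ∈ S then 1 else 0) = 0 := by omega
      rw [cutColoring, if_neg ht]; exact sub_eq_of_eq_add h'.symm
  · rw [Fin.zero_of_val_eq_zero hx]; simp [cutColoring]
  · obtain ⟨e, he, hcard⟩ := Finset.exists_subset_card_eq (s := Sᶜ) (n := n - 2) (by omega)
    refine ⟨e, hcard, 0 - (if (0 : Fin n) ∈ S then 1 else 0), fun x hx => ?_⟩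
    have := he hx
    rw [Finset.mem_compl] at this
    simp only [cutColoring, this, if_false]

theorem pairColoring_mem {n : ℕ} [NeZero n] (hn : 5 ≤ n) {a b : Fin n} (hab : a ≠ b) :
    Surjective (pairColoring a b) ∧ (∀ x : Fin n, (x : ℕ) = 0 → (pairColoring a b x : ℕ) = 0) ∧
      completeIn n (n - 2) 3 (pairColoring a b) := by
  have hc : ({a, b} : Finset (Fin n))ᶜ.card = n - 2 := by
    rw [Finset.card_compl, Fintype.card_fin, Finset.card_pair hab]
  have hsurj : Surjective (pairPosition a b) := by
    obtain ⟨t, ht⟩ : ({a, b} : Finset (Fin n))ᶜ.Nonempty := Finset.card_pos.1 (by omega)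
    simp only [Finset.mem_compl, Finset.mem_insert, Finset.mem_singleton, not_or] at ht
    intro y
    fin_cases y
    · exact ⟨t, pairPosition_zero_of_ne ht.1 ht.2⟩
    · exact ⟨a, by simp [pairPosition]⟩
    · exact ⟨b, by simp [pairPosition, hab.symm]⟩
  refine ⟨fun y => ?_, fun x hx => ?_, ({a, b} : Finset (Fin n))ᶜ, hc,
    0 - pairPosition a b 0, fun x hx => ?_⟩
  · obtain ⟨x, hx⟩ := hsurj (y + pairPosition a b 0)
    exact ⟨x, by simp [pairColoring, hx]⟩
  · rw [Fin.zero_of_val_eq_zero hx]; simp [pairColoring]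
  · simp only [Finset.mem_compl, Finset.mem_insert, Finset.mem_singleton, not_or] at hx
    simp only [pairColoring, pairPosition_zero_of_ne hx.1 hx.2]

/-- Two-block faces correspond to their small blocks. -/
noncomputable def cutEquiv {n : ℕ} [NeZero n] (hn : 5 ≤ n) :
    {S : Finset (Fin n) // S.card = 1 ∨ S.card = 2} ≃ CycBas n (completeIn n (n - 2)) 2 :=
  Equiv.ofBijective (fun S => ⟨cutColoring S.1, cutColoring_mem hn S.2⟩) <| by
    refine ⟨fun S T h => Subtype.ext (cutColoring_injective ?_ (congrArg Subtype.val h)),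
      fun f => ?_⟩
    · have := S.2; have := T.2; omega
    · obtain ⟨S, hS, h⟩ := exists_cutColoring f.2.1
        (Fin.zero_of_val_eq_zero (f.2.2.1 0 (by simp))) f.2.2.2
      exact ⟨⟨S, hS⟩, Subtype.ext h⟩

/-- Three-block faces correspond to ordered pairs of distinct vertices. -/
noncomputable def pairEquiv {n : ℕ} [NeZero n] (hn : 5 ≤ n) :
    {p : Fin n × Fin n // p.1 ≠ p.2} ≃ CycBas n (completeIn n (n - 2)) 3 :=
  Equiv.ofBijective (fun p => ⟨pairColoring p.1.1 p.1.2, pairColoring_mem hn p.2⟩) <| by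
    refine ⟨fun p q h => ?_, fun f => ?_⟩
    · have := pairColoring_injective hn p.2 (congrArg Subtype.val h)
      exact Subtype.ext (Prod.ext this.1 this.2)
    · obtain ⟨a, b, hab, h⟩ := exists_pairColoring (by omega) f.2.1
        (Fin.zero_of_val_eq_zero (f.2.2.1 0 (by simp))) f.2.2.2
      exact ⟨⟨(a, b), hab⟩, Subtype.ext h⟩

/-- The map identifying the last block of a three-block partition with the first one. -/
def wrapMap : Fin 3 → Fin 2 := ![0, 1, 0]

theorem wrap_iff {n : ℕ} (f : Fin n → Fin 3) (g : Fin n → Fin 2) :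
    (∀ y : Fin n, ((f y : ℕ) = 2 → (g y : ℕ) = 0) ∧ ((f y : ℕ) ≠ 2 → (g y : ℕ) = (f y : ℕ))) ↔
      wrapMap ∘ f = g := by
  rw [funext_iff]
  refine forall_congr' fun y => ?_
  simp only [comp_apply]
  generalize f y = u
  generalize g y = v
  decide +revert

theorem merge_pairColoring {n : ℕ} [NeZero n] {a b : Fin n} (hab : a ≠ b) :
    (0 ≠ a ∧ 0 ≠ b ∧ mergeMap 0 ∘ pairColoring a b = cutColoring {b} ∧
      mergeMap 1 ∘ pairColoring a b = cutColoring {a, b} ∧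
      wrapMap ∘ pairColoring a b = cutColoring {a}) ∨
    (0 = a ∧ 0 ≠ b ∧ mergeMap 0 ∘ pairColoring a b = cutColoring {a, b} ∧
      mergeMap 1 ∘ pairColoring a b = cutColoring {a} ∧
      wrapMap ∘ pairColoring a b = cutColoring {b}) ∨
    (0 ≠ a ∧ 0 = b ∧ mergeMap 0 ∘ pairColoring a b = cutColoring {a} ∧
      mergeMap 1 ∘ pairColoring a b = cutColoring {b} ∧
      wrapMap ∘ pairColoring a b = cutColoring {a, b}) := by
  by_cases ha : 0 = a
  · have hb : 0 ≠ b := fun h => hab (ha.symm.trans h)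
    refine Or.inr (Or.inl ⟨ha, hb, ?_, ?_, ?_⟩) <;> funext x <;>
      by_cases h1 : x = a <;> by_cases h2 : x = b <;>
      simp_all [pairColoring, pairPosition, cutColoring, mergeMap, wrapMap] <;> rfl
  · by_cases hb : 0 = b
    · refine Or.inr (Or.inr ⟨ha, hb, ?_, ?_, ?_⟩) <;> funext x <;>
        by_cases h1 : x = a <;> by_cases h2 : x = b <;>
        simp_all [pairColoring, pairPosition, cutColoring, mergeMap, wrapMap] <;> rfl
    · refine Or.inl ⟨ha, hb, ?_, ?_, ?_⟩ <;> funext x <;>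
        by_cases h1 : x = a <;> by_cases h2 : x = b <;>
        simp_all [pairColoring, pairPosition, cutColoring, mergeMap, wrapMap]

theorem cutColoring_eq_iff {n : ℕ} [NeZero n] {S T : Finset (Fin n)}
    (hST : S.card + T.card < n) : cutColoring S = cutColoring T ↔ S = T :=
  ⟨cutColoring_injective hST, fun h => h ▸ rfl⟩

theorem singleton_ne_pair {α : Type*} [DecidableEq α] {a b : α} (hab : a ≠ b) (x : α) :
    ({x} : Finset α) ≠ {a, b} := fun h => by
  have := congrArg Finset.card h
  rw [Finset.card_singleton, Finset.card_pair hab] at this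
  omega

theorem cycMat_pairEquiv_cutEquiv {n : ℕ} [NeZero n] (hn : 5 ≤ n)
    (p : {p : Fin n × Fin n // p.1 ≠ p.2})
    (S : {S : Finset (Fin n) // S.card = 1 ∨ S.card = 2}) :
    cycMat n (completeIn n (n - 2)) 2 (pairEquiv hn p) (cutEquiv hn S) =
      (if (0 : Fin n) ∈ S.1 then -1 else 1) *
        ((if {p.1.1} = S.1 then 1 else 0) + (if {p.1.2} = S.1 then 1 else 0)
          - (if {p.1.1, p.1.2} = S.1 then 1 else 0)) := by
  obtain ⟨⟨a, b⟩, hab⟩ := p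
  obtain ⟨S, hS⟩ := S
  change a ≠ b at hab
  have hp : (pairEquiv hn ⟨(a, b), hab⟩).1 = pairColoring a b := rfl
  have hc : (cutEquiv hn ⟨S, hS⟩).1 = cutColoring S := rfl
  have e1 : cutColoring {a} = cutColoring S ↔ {a} = S :=
    cutColoring_eq_iff (by rw [Finset.card_singleton]; omega)
  have e2 : cutColoring {b} = cutColoring S ↔ {b} = S :=
    cutColoring_eq_iff (by rw [Finset.card_singleton]; omega)
  have e3 : cutColoring {a, b} = cutColoring S ↔ {a, b} = S :=
    cutColoring_eq_iff (by rw [Finset.card_pair hab]; omega)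
  have n1 : ({a} : Finset (Fin n)) ≠ {a, b} := singleton_ne_pair hab _
  have n2 : ({b} : Finset (Fin n)) ≠ {a, b} := singleton_ne_pair hab _
  have n3 : ({a} : Finset (Fin n)) ≠ {b} := fun h => hab (Finset.singleton_injective h)
  unfold cycMat
  simp only [wrap_iff, Fin.sum_univ_two, hp, hc]
  rcases merge_pairColoring hab with ⟨ha, hb, h1, h2, h3⟩ | ⟨ha, hb, h1, h2, h3⟩ |
    ⟨ha, hb, h1, h2, h3⟩ <;>
  · simp only [h1, h2, h3, e1, e2, e3]
    by_cases s1 : {a} = S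
    · subst s1; simp [n1.symm, n3.symm, ha, hb, hab.symm]
    · by_cases s2 : {b} = S
      · subst s2; simp [n2.symm, n3, ha, hb, hab]
      · by_cases s3 : {a, b} = S
        · subst s3; simp [n1, n2, ha, hb]
        · simp [s1, s2, s3]

theorem mem_ker_cycBnd_two_iff {n : ℕ} [NeZero n] (hn : 5 ≤ n)
    (c : CycBas n (completeIn n (n - 2)) 3 → ℚ) :
    c ∈ LinearMap.ker (cycBnd n (completeIn n (n - 2)) 2) ↔
      ∀ (a b : Fin n) (h : a ≠ b),
        c (pairEquiv hn ⟨(b, a), h.symm⟩) = - c (pairEquiv hn ⟨(a, b), h⟩) := by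
  have key : ∀ S, cycBnd n (completeIn n (n - 2)) 2 c (cutEquiv hn S) =
      ∑ p, c (pairEquiv hn p) *
        cycMat n (completeIn n (n - 2)) 2 (pairEquiv hn p) (cutEquiv hn S) := fun S =>
    ((pairEquiv hn).sum_comp (fun f =>
      c f * cycMat n (completeIn n (n - 2)) 2 f (cutEquiv hn S))).symm
  simp only [cycMat_pairEquiv_cutEquiv] at key
  rw [LinearMap.mem_ker]
  constructor
  · intro h a b hab
    have h1 := key ⟨{a, b}, Or.inr (Finset.card_pair hab)⟩
    rw [h, Fintype.sum_eq_add (⟨(a, b), hab⟩ : {p : Fin n × Fin n // p.1 ≠ p.2})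
      ⟨(b, a), hab.symm⟩] at h1
    · have e1 : ({a} : Finset (Fin n)) ≠ {a, b} := singleton_ne_pair hab _
      have e2 : ({b} : Finset (Fin n)) ≠ {a, b} := singleton_ne_pair hab _
      simp only [e1, e2, Finset.pair_comm b a, if_true, if_false, Pi.zero_apply] at h1
      split_ifs at h1 <;> linarith
    · exact fun h' => hab (congrArg (fun p => p.1.1) h')
    · rintro ⟨⟨x, y⟩, hxy⟩ ⟨hp, hq⟩
      have e1 : ({x} : Finset (Fin n)) ≠ {a, b} := singleton_ne_pair hab _
      have e2 : ({y} : Finset (Fin n)) ≠ {a, b} := singleton_ne_pair hab _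
      have e3 : ({x, y} : Finset (Fin n)) ≠ {a, b} := fun h => by
        have hx : x ∈ ({a, b} : Finset (Fin n)) := h ▸ by simp
        have hy : y ∈ ({a, b} : Finset (Fin n)) := h ▸ by simp
        simp only [Finset.mem_insert, Finset.mem_singleton] at hx hy
        rcases hx with rfl | rfl <;> rcases hy with rfl | rfl
        exacts [hxy rfl, hp rfl, hq rfl, hxy rfl]
      simp [e1, e2, e3]
  · intro h
    funext f
    obtain ⟨S, rfl⟩ := (cutEquiv hn).surjective f
    rw [key]
    let σ : {p : Fin n × Fin n // p.1 ≠ p.2} ≃ {p : Fin n × Fin n // p.1 ≠ p.2} :=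
      ⟨fun p => ⟨(p.1.2, p.1.1), p.2.symm⟩, fun p => ⟨(p.1.2, p.1.1), p.2.symm⟩,
        fun p => rfl, fun p => rfl⟩
    have hs := σ.sum_comp (fun p => c (pairEquiv hn p) *
      ((if (0 : Fin n) ∈ S.1 then -1 else 1) *
        ((if {p.1.1} = S.1 then 1 else 0) + (if {p.1.2} = S.1 then 1 else 0)
          - (if {p.1.1, p.1.2} = S.1 then 1 else 0))))
    rw [Pi.zero_apply, ← self_eq_neg]
    conv_lhs => rw [← hs]
    rw [← Finset.sum_neg_distrib]
    refine Finset.sum_congr rfl fun p _ => ?_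
    change c (pairEquiv hn ⟨(p.1.2, p.1.1), p.2.symm⟩) * _ = _
    rw [h _ _ p.2]
    simp only [σ, Equiv.coe_fn_mk, Finset.pair_comm p.1.2 p.1.1]
    ring

/-- Cycles in top degree are determined by their values on increasing pairs. -/
noncomputable def kerCycBndTwoEquiv {n : ℕ} [NeZero n] (hn : 5 ≤ n) :
    LinearMap.ker (cycBnd n (completeIn n (n - 2)) 2) ≃ₗ[ℚ]
      ({p : Fin n × Fin n // p.1 < p.2} → ℚ) where
  toFun c p := c.1 (pairEquiv hn ⟨p.1, p.2.ne⟩)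
  map_add' _ _ := rfl
  map_smul' _ _ := rfl
  invFun u := ⟨fun f =>
    if h : ((pairEquiv hn).symm f).1.1 < ((pairEquiv hn).symm f).1.2 then
      u ⟨((pairEquiv hn).symm f).1, h⟩
    else - u ⟨((pairEquiv hn).symm f).1.swap,
      lt_of_le_of_ne (not_lt.1 h) ((pairEquiv hn).symm f).2.symm⟩, by
    rw [mem_ker_cycBnd_two_iff hn]
    intro a b hab
    simp only [Equiv.symm_apply_apply]
    rcases lt_or_gt_of_ne hab with h | h
    · simp [h, h.not_gt]
    · simp [h, h.not_gt]⟩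
  left_inv c := by
    have hc := (mem_ker_cycBnd_two_iff hn c.1).1 c.2
    refine Subtype.ext (funext fun f => ?_)
    obtain ⟨⟨⟨a, b⟩, hab⟩, rfl⟩ := (pairEquiv hn).surjective f
    simp only [Equiv.symm_apply_apply]
    split_ifs with h
    · rfl
    · rw [← hc]; rfl
  right_inv u := by
    funext p
    simp [p.2]

theorem card_ne_pairs (n : ℕ) :
    Fintype.card {p : Fin n × Fin n // p.1 ≠ p.2} = n * (n - 1) := by
  have h : (Finset.univ : Finset (Fin n)).offDiag =
      Finset.univ.filter (fun p : Fin n × Fin n => p.1 ≠ p.2) := by ext; simp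
  rw [Fintype.card_subtype, ← h, Finset.offDiag_card, Finset.card_univ, Fintype.card_fin,
    Nat.mul_sub_one]

theorem card_lt_pairs (n : ℕ) :
    Fintype.card {p : Fin n × Fin n // p.1 < p.2} = n.choose 2 := by
  have hswap : Fintype.card {p : Fin n × Fin n // p.2 < p.1} =
      Fintype.card {p : Fin n × Fin n // p.1 < p.2} :=
    Fintype.card_congr ((Equiv.prodComm _ _).subtypeEquiv fun p => Iff.rfl)
  have h : Fintype.card {p : Fin n × Fin n // p.1 ≠ p.2} =
      Fintype.card {p : Fin n × Fin n // p.1 < p.2} +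
        Fintype.card {p : Fin n × Fin n // p.2 < p.1} := by
    rw [← Fintype.card_subtype_or_disjoint]
    · exact Fintype.card_congr (Equiv.subtypeEquivRight fun p => ne_iff_lt_or_gt)
    · exact Pi.disjoint_iff.2 fun p => Prop.disjoint_iff.2 fun h => lt_asymm h.1 h.2
  rw [hswap] at h
  rw [card_ne_pairs] at h
  rw [Nat.choose_two_right]
  omega

theorem card_one_or_two (n : ℕ) :
    Fintype.card {S : Finset (Fin n) // S.card = 1 ∨ S.card = 2} = n + n.choose 2 := by
  rw [Fintype.card_subtype, Finset.filter_or, Finset.card_union_of_disjoint]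
  · simp
  · exact Finset.disjoint_filter.2 fun S _ h1 h2 => by omega

theorem finrank_homologyOf {R A B C : Type} [Field R] [AddCommGroup A] [AddCommGroup B]
    [AddCommGroup C] [Module R A] [Module R B] [Module R C] [FiniteDimensional R B]
    (d2 : A →ₗ[R] B) (d1 : B →ₗ[R] C) (h : LinearMap.range d2 ≤ LinearMap.ker d1) :
    Module.finrank R (homologyOf d2 d1) + Module.finrank R (LinearMap.range d2) =
      Module.finrank R (LinearMap.ker d1) := by
  rw [← Submodule.finrank_quotient_add_finrank
    ((LinearMap.range d2).comap (LinearMap.ker d1).subtype),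
    (Submodule.comapSubtypeEquivOfLe h).finrank_eq]

theorem cycBnd_one_eq_zero {n : ℕ} (P : (m : ℕ) → (Fin n → Fin m) → Prop) :
    cycBnd n P 1 = 0 := by
  refine LinearMap.ext fun c => funext fun g => ?_
  change ∑ f, c f * cycMat n P 1 f g = 0
  refine Finset.sum_eq_zero fun f _ => ?_
  have h1 : mergeMap (0 : Fin 1) ∘ f.1 = g.1 := Subsingleton.elim _ _
  have h2 : ∀ y : Fin n, ((f.1 y : ℕ) = 1 → (g.1 y : ℕ) = 0) ∧
      ((f.1 y : ℕ) ≠ 1 → (g.1 y : ℕ) = (f.1 y : ℕ)) := fun y => by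
    have := (f.1 y).isLt
    have := (g.1 y).isLt
    omega
  rw [cycMat, if_pos h2, Fin.sum_univ_one, if_pos h1]
  simp

theorem isEmpty_cycBas_four {n : ℕ} (hn : 2 ≤ n) :
    IsEmpty (CycBas n (completeIn n (n - 2)) 4) := by
  refine ⟨fun ⟨f, hf, _, e, he, i, hi⟩ => ?_⟩
  have h : ({i + 1, i + 2, i + 3} : Finset (Fin 4)) ⊆ eᶜ.image f := by
    intro y hy
    obtain ⟨x, rfl⟩ := hf y
    refine Finset.mem_image_of_mem _ (Finset.mem_compl.2 fun hx => ?_)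
    rw [hi x hx] at hy
    clear hi hx he
    revert hy
    decide +revert
  have h3 : ({i + 1, i + 2, i + 3} : Finset (Fin 4)).card = 3 := by
    clear h hi
    decide +revert
  have h1 := (Finset.card_le_card h).trans Finset.card_image_le
  rw [h3, Finset.card_compl, Fintype.card_fin, he] at h1
  omega

theorem card_cycBas_one {n : ℕ} [NeZero n] :
    Fintype.card (CycBas n (completeIn n (n - 2)) 1) = 1 := by
  obtain ⟨e, -, he⟩ := Finset.exists_subset_card_eq
    (s := (Finset.univ : Finset (Fin n))) (n := n - 2) (by simp)
  refine Fintype.card_eq_one_iff.2 ⟨⟨fun _ => 0, fun y => ⟨0, Subsingleton.elim _ _⟩,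
    fun _ _ => rfl, e, he, 0, fun _ _ => rfl⟩, fun f => Subtype.ext (Subsingleton.elim _ _)⟩

/-- Theorem (paper Thm. `special_case_2`): for the complete `(n-2)`-uniform hypergraph `H`
on `n ≥ 5` vertices, `dim HC_r(Δ(H)) = C(n, r+1)` for `-1 ≤ r ≤ 1`.  Below, `q = r + 1`,
and homological degree `r` corresponds to partitions with `r + 2 = q + 1` blocks. -/
theorem dim_HC_cyclic_complete_unif_pred2 (n : ℕ) (hn : 5 ≤ n) :
    ∀ q : ℕ, q ≤ 2 →
      Module.finrank ℚ (homologyOf (cycBnd n (completeIn n (n - 2)) (q + 1))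
        (cycBnd n (completeIn n (n - 2)) q)) = Nat.choose n q := by
  have : NeZero n := ⟨by omega⟩
  have hker : Module.finrank ℚ (LinearMap.ker (cycBnd n (completeIn n (n - 2)) 2)) =
      n.choose 2 := by
    rw [(kerCycBndTwoEquiv hn).finrank_eq, Module.finrank_fintype_fun_eq_card, card_lt_pairs]
  have hrank := LinearMap.finrank_range_add_finrank_ker (cycBnd n (completeIn n (n - 2)) 2)
  rw [Module.finrank_fintype_fun_eq_card, ← Fintype.card_congr (pairEquiv hn), card_ne_pairs,
    hker] at hrank
  have hchoose := Nat.choose_two_right n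
  have heven := (Nat.even_mul_pred_self n).two_dvd
  have hempty := isEmpty_cycBas_four (n := n) (by omega)
  intro q hq
  interval_cases q
  · have h0 : cycBnd n (completeIn n (n - 2)) 0 = 0 :=
      LinearMap.ext fun c => funext fun g => (g.1 0).elim0
    have hk : Module.finrank ℚ (LinearMap.ker (cycBnd n (completeIn n (n - 2)) 0)) = 1 := by
      rw [h0, LinearMap.ker_zero, finrank_top, Module.finrank_fintype_fun_eq_card]
      exact card_cycBas_one
    have hr : Module.finrank ℚ (LinearMap.range (cycBnd n (completeIn n (n - 2)) 1)) = 0 := by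
      rw [cycBnd_one_eq_zero, LinearMap.range_zero, finrank_bot]
    have h := (finrank_homologyOf (cycBnd n (completeIn n (n - 2)) (0 + 1))
      (cycBnd n (completeIn n (n - 2)) 0) (by rw [h0, LinearMap.ker_zero]; exact le_top)).trans hk
    rw [Nat.choose_zero_right]
    exact (congrArg _ hr.symm).trans h
  · have hk : Module.finrank ℚ (LinearMap.ker (cycBnd n (completeIn n (n - 2)) 1)) =
        n + n.choose 2 := by
      rw [cycBnd_one_eq_zero, LinearMap.ker_zero, finrank_top, Module.finrank_fintype_fun_eq_card,
        ← card_one_or_two]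
      exact (Fintype.card_congr (cutEquiv hn)).symm
    have h : Module.finrank ℚ (homologyOf (cycBnd n (completeIn n (n - 2)) (1 + 1))
          (cycBnd n (completeIn n (n - 2)) 1)) +
        Module.finrank ℚ (LinearMap.range (cycBnd n (completeIn n (n - 2)) 2)) =
          n + n.choose 2 :=
      (finrank_homologyOf _ _
        (by rw [cycBnd_one_eq_zero, LinearMap.ker_zero]; exact le_top)).trans hk
    rw [Nat.choose_one_right]
    omega
  · have h0 : cycBnd n (completeIn n (n - 2)) 3 = 0 :=
      LinearMap.ext fun c => by rw [Subsingleton.elim c 0, map_zero, map_zero]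
    have hr : Module.finrank ℚ (LinearMap.range (cycBnd n (completeIn n (n - 2)) 3)) = 0 := by
      rw [h0, LinearMap.range_zero, finrank_bot]
    have h := (finrank_homologyOf (cycBnd n (completeIn n (n - 2)) (2 + 1))
      (cycBnd n (completeIn n (n - 2)) 2)
      (by change LinearMap.range (cycBnd n (completeIn n (n - 2)) 3) ≤ _
          rw [h0, LinearMap.range_zero]; exact bot_le)).trans hker
    exact (congrArg _ hr.symm).trans h
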